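/- arXiv:1610.08189 — 4 statements merged into one kernel-verified Lean document; each statement's English description precedes it below -/
import Mathlib

section
/- Let A be an N×N real matrix with zero diagonal entries (a_jj = 0 for all j) such that I − A is invertible, and let B be an N×N diagonal matrix with nonzero diagonal entries (b_jj ≠ 0 for all j, b_ij = 0 for i ≠ j). Then the matrix 𝒜 := (I − A)⁻¹ B is invertible and A can be uniquely expressed in terms of 𝒜 as A = I − (Diag(𝒜⁻¹))⁻¹ 𝒜⁻¹, where Diag(M) denotes the diagonal matrix whose diagonal coincides with that of M. -/
open Matrix

/-- If `A` has zero diagonal with `I - A` invertible and `B` is diagonal with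
nonzero diagonal entries, then `𝒜 := (I - A)⁻¹ * B` is invertible and
`A = I - (Diag(𝒜⁻¹))⁻¹ * 𝒜⁻¹`. -/
theorem sem_topology_recovery {N : ℕ} (A B : Matrix (Fin N) (Fin N) ℝ)
    (hAdiag : ∀ j, A j j = 0) (hInv : IsUnit (1 - A))
    (hBdiag : B.IsDiag) (hBnz : ∀ j, B j j ≠ 0) :
    IsUnit ((1 - A)⁻¹ * B) ∧
      A = 1 - (Matrix.diagonal (((1 - A)⁻¹ * B)⁻¹).diag)⁻¹ * ((1 - A)⁻¹ * B)⁻¹ := by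
  obtain ⟨b, rfl⟩ : ∃ b, B = Matrix.diagonal b := ⟨B.diag, hBdiag.diagonal_diag.symm⟩
  have hb : ∀ j, b j ≠ 0 := fun j => by simpa using hBnz j
  have h1 : Matrix.diagonal b * Matrix.diagonal (fun j => (b j)⁻¹) = 1 := by
    rw [Matrix.diagonal_mul_diagonal, ← Matrix.diagonal_one]
    congr 1
    funext j
    exact mul_inv_cancel₀ (hb j)
  have hBinv : (Matrix.diagonal b)⁻¹ = Matrix.diagonal (fun j => (b j)⁻¹) :=
    Matrix.inv_eq_right_inv h1
  have hdet : IsUnit (1 - A).det := (Matrix.isUnit_iff_isUnit_det _).1 hInv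
  have hinv : ((1 - A)⁻¹ * Matrix.diagonal b)⁻¹
      = Matrix.diagonal (fun j => (b j)⁻¹) * (1 - A) := by
    rw [Matrix.mul_inv_rev, Matrix.nonsing_inv_nonsing_inv _ hdet, hBinv]
  refine ⟨((Matrix.isUnit_nonsing_inv_iff).2 hInv).mul
    (IsUnit.of_mul_eq_one _ h1), ?_⟩
  have hd : (Matrix.diagonal (fun j => (b j)⁻¹) * (1 - A)).diag = fun j => (b j)⁻¹ := by
    funext j
    simp [Matrix.diag, Matrix.diagonal_mul, hAdiag j]
  rw [hinv, hd, Matrix.inv_eq_left_inv h1, ← mul_assoc, h1, one_mul, sub_sub_cancel]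
end

section
/- Let R be an M×N real matrix such that any two distinct columns of R are linearly independent (i.e., the Kruskal rank of R is at least 2), let Π be an N×N permutation matrix, and let Λ be an N×N diagonal matrix with nonzero diagonal entries. If R = R Π Λ, then Π = I and Λ = I. -/
open Matrix

/-- If every column of `R` is nonzero and any two distinct columns of `R` are
linearly independent (Kruskal rank at least 2), `Π` is a permutation matrix and `Λ` a diagonal
matrix with nonzero diagonal entries, then `R = R Π Λ` implies `Π = I` and `Λ = I`. -/
theorem perm_scaling_identity_of_kruskal_two {M N : ℕ} (R : Matrix (Fin M) (Fin N) ℝ)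
    (hnz : ∀ i : Fin N, (fun m => R m i) ≠ 0)
    (hli : ∀ i j : Fin N, i ≠ j →
      LinearIndependent ℝ ![fun m => R m i, fun m => R m j])
    (σ : Equiv.Perm (Fin N)) (d : Fin N → ℝ) (hd : ∀ i, d i ≠ 0)
    (heq : R = R * σ.permMatrix ℝ * Matrix.diagonal d) :
    σ.permMatrix ℝ = 1 ∧ Matrix.diagonal d = 1 := by
  have key : ∀ m i, R m i = R m (σ.symm i) * d i := by
    intro m i
    have h := congrFun (congrFun heq m) i
    rw [Matrix.mul_diagonal, Equiv.Perm.permMatrix, PEquiv.mul_toMatrix_toPEquiv] at h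
    simpa using h
  have hσ : ∀ i, σ.symm i = i := by
    intro i
    by_contra hne
    have h := LinearIndependent.pair_iff.mp (hli i (σ.symm i) (Ne.symm hne)) 1 (-d i) (by
      funext m
      have := key m i
      simp only [Pi.add_apply, Pi.smul_apply, smul_eq_mul, Pi.zero_apply]
      linarith)
    exact one_ne_zero h.1
  have hσ1 : σ = 1 := by
    ext i
    have h := hσ (σ i)
    rw [Equiv.symm_apply_apply] at h
    simp [← h]
  have hd1 : d = 1 := by
    funext i
    obtain ⟨m, hm⟩ := Function.ne_iff.mp (hnz i)
    have h := key m i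
    rw [hσ i] at h
    have hm' : R m i ≠ 0 := hm
    exact mul_left_cancel₀ hm' (by simp [← h])
  subst hσ1 hd1
  exact ⟨by simp, Matrix.diagonal_one⟩
end

section
/- Let 𝒜 be an invertible N×N real matrix, and let Λ be an invertible N×N diagonal matrix. Then the recovery map is invariant under right diagonal scaling: I − (Diag((𝒜Λ)⁻¹))⁻¹ (𝒜Λ)⁻¹ = I − (Diag(𝒜⁻¹))⁻¹ 𝒜⁻¹, provided Diag(𝒜⁻¹) is invertible. In particular, if A has zero diagonal with I − A invertible, B is diagonal with nonzero diagonal entries, 𝒜 = (I − A)⁻¹B, and the PARAFAC factor estimate satisfies 𝒜̂ = 𝒜Λ, then the recovered matrix Â = I − (Diag(𝒜̂⁻¹))⁻¹ 𝒜̂⁻¹ equals A. -/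
open Matrix

theorem recovery_aux {N : ℕ} (C : Matrix (Fin N) (Fin N) ℝ) (d : Fin N → ℝ)
    (hd : ∀ i, d i ≠ 0) :
    (Matrix.diagonal (((C * Matrix.diagonal d)⁻¹).diag))⁻¹ * (C * Matrix.diagonal d)⁻¹
      = (Matrix.diagonal ((C⁻¹).diag))⁻¹ * C⁻¹ := by
  have hu : IsUnit (Matrix.diagonal d).det := by
    rw [Matrix.det_diagonal, isUnit_iff_ne_zero]
    exact Finset.prod_ne_zero_iff.mpr fun i _ => hd i
  have hinv : (Matrix.diagonal d)⁻¹ = Matrix.diagonal (fun i => (d i)⁻¹) := by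
    apply Matrix.inv_eq_right_inv
    rw [Matrix.diagonal_mul_diagonal, ← Matrix.diagonal_one]
    congr 1
    funext i
    exact mul_inv_cancel₀ (hd i)
  have hdiag : Matrix.diagonal (((C * Matrix.diagonal d)⁻¹).diag)
      = (Matrix.diagonal d)⁻¹ * Matrix.diagonal ((C⁻¹).diag) := by
    rw [Matrix.mul_inv_rev, hinv, Matrix.diagonal_mul_diagonal]
    congr 1
    funext i
    simp [Matrix.diag_apply, Matrix.diagonal_mul]
  rw [hdiag, Matrix.mul_inv_rev, Matrix.mul_inv_rev, Matrix.nonsing_inv_nonsing_inv _ hu,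
    Matrix.mul_assoc, Matrix.mul_nonsing_inv_cancel_left _ _ hu]

/-- The topology-recovery map `C ↦ I - (Diag(C⁻¹))⁻¹ C⁻¹` is invariant under
right multiplication by an invertible diagonal matrix `Λ`; in particular, if
`𝒜 = (I - A)⁻¹ B` (with `A` having zero diagonal, `I - A` invertible, `B` diagonal with
nonzero diagonal entries) and the PARAFAC estimate is `𝒜̂ = 𝒜 Λ`, then the recovered matrix
`I - (Diag(𝒜̂⁻¹))⁻¹ 𝒜̂⁻¹` equals `A`. -/
theorem recovery_invariant_under_diagonal_scaling {N : ℕ}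
    (A B : Matrix (Fin N) (Fin N) ℝ) (d : Fin N → ℝ)
    (hAdiag : ∀ j, A j j = 0) (hInv : IsUnit (1 - A))
    (hBdiag : B.IsDiag) (hBnz : ∀ j, B j j ≠ 0)
    (hd : ∀ i, d i ≠ 0) :
    (∀ C : Matrix (Fin N) (Fin N) ℝ, IsUnit C → IsUnit (Matrix.diagonal (C⁻¹).diag) →
      1 - (Matrix.diagonal (((C * Matrix.diagonal d)⁻¹).diag))⁻¹ * (C * Matrix.diagonal d)⁻¹
        = 1 - (Matrix.diagonal ((C⁻¹).diag))⁻¹ * C⁻¹) ∧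
    1 - (Matrix.diagonal ((((1 - A)⁻¹ * B * Matrix.diagonal d)⁻¹).diag))⁻¹
        * ((1 - A)⁻¹ * B * Matrix.diagonal d)⁻¹ = A := by
  refine ⟨fun C _ _ => by rw [recovery_aux C d hd], ?_⟩
  have hB : B = Matrix.diagonal B.diag := hBdiag.diagonal_diag.symm
  have hA : Matrix.diagonal ((1 - A).diag) = 1 := by
    rw [← Matrix.diagonal_one]
    congr 1
    funext i
    simp [hAdiag]
  rw [recovery_aux _ d hd, hB, recovery_aux _ B.diag hBnz,
    Matrix.nonsing_inv_nonsing_inv _ ((Matrix.isUnit_iff_isUnit_det _).mp hInv), hA]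
  simp
end

section
/- Let A be an N×N real matrix with zero diagonal such that I − A is invertible, let B be a diagonal N×N matrix with nonzero diagonal entries, and set 𝒜 := (I − A)⁻¹B. Let R^x ∈ R^{M×N} have the property that any two distinct columns are linearly independent (Kruskal rank at least 2). Suppose (𝒜′, 𝒜′, R′) is an alternative PARAFAC factor triple related to (𝒜, 𝒜, R^x) by the essential-uniqueness relations: there exist a permutation matrix Π and diagonal matrices Λ₁, Λ₂, Λ₃ with Λ₁Λ₂Λ₃ = I such that 𝒜′ = 𝒜ΠΛ₁, 𝒜′ = 𝒜ΠΛ₂, and R′ = R^xΠΛ₃. If additionally R′ = R^x (the exogenous correlation matrix is fully known), then the recovered adjacency matrix satisfies I − (Diag(𝒜′⁻¹))⁻¹ 𝒜′⁻¹ = A; that is, A is uniquely identified. -/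
open Matrix

/-- (Identifiability with fully known `R^x`.)  Let `𝒜 = (I - A)⁻¹ B` with `A`
having zero diagonal, `I - A` invertible, and `B` diagonal with nonzero diagonal entries.
Suppose every column of `R^x` is nonzero and any two distinct columns of `R^x` are linearly
independent (Kruskal rank at least 2).  If an alternative PARAFAC triple `(𝒜', 𝒜', R')` is
related to `(𝒜, 𝒜, R^x)` by the essential-uniqueness relations `𝒜' = 𝒜 Π Λ₁ = 𝒜 Π Λ₂`,
`R' = R^x Π Λ₃` with `Λ₁ Λ₂ Λ₃ = I`, and moreover `R' = R^x`, then
`I - (Diag(𝒜'⁻¹))⁻¹ 𝒜'⁻¹ = A`. -/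
theorem topology_identifiable_full_Rx {N M : ℕ}
    (A B 𝒜' : Matrix (Fin N) (Fin N) ℝ) (Rx R' : Matrix (Fin M) (Fin N) ℝ)
    (hAdiag : ∀ j, A j j = 0) (hInv : IsUnit (1 - A))
    (hBdiag : B.IsDiag) (hBnz : ∀ j, B j j ≠ 0)
    (hnz : ∀ i : Fin N, (fun m => Rx m i) ≠ 0)
    (hli : ∀ i j : Fin N, i ≠ j →
      LinearIndependent ℝ ![fun m => Rx m i, fun m => Rx m j])
    (σ : Equiv.Perm (Fin N)) (d₁ d₂ d₃ : Fin N → ℝ)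
    (hΛ : Matrix.diagonal d₁ * Matrix.diagonal d₂ * Matrix.diagonal d₃ = 1)
    (h1 : 𝒜' = ((1 - A)⁻¹ * B) * σ.permMatrix ℝ * Matrix.diagonal d₁)
    (h2 : 𝒜' = ((1 - A)⁻¹ * B) * σ.permMatrix ℝ * Matrix.diagonal d₂)
    (h3 : R' = Rx * σ.permMatrix ℝ * Matrix.diagonal d₃)
    (hknown : R' = Rx) :
    1 - (Matrix.diagonal ((𝒜'⁻¹).diag))⁻¹ * 𝒜'⁻¹ = A := by
  have hd : ∀ j, d₁ j ≠ 0 := by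
    intro j h0
    have := congrFun (congrFun hΛ j) j
    simp [Matrix.diagonal_mul_diagonal, h0] at this
  have hcol : ∀ m j, Rx m j = Rx m (σ.symm j) * d₃ j := by
    intro m j
    have := congrFun (congrFun (hknown.symm.trans h3) m) j
    rw [Matrix.mul_diagonal, Equiv.Perm.permMatrix, PEquiv.mul_toMatrix_toPEquiv] at this
    simpa using this
  have hσ : σ = 1 := by
    have key : ∀ j, σ.symm j = j := by
      intro j
      by_contra hne
      have h := LinearIndependent.pair_iff.1 (hli _ _ hne) (d₃ j) (-1) (by
        ext m
        have := hcol m j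
        simp only [Pi.add_apply, Pi.smul_apply, smul_eq_mul, Pi.zero_apply]
        linarith)
      norm_num at h
    ext j
    have := key (σ j)
    simp at this
    simp [← this]
  subst hσ
  have hB : B = Matrix.diagonal (fun j => B j j) := by
    ext i j
    by_cases hij : i = j
    · subst hij; simp
    · simp [hij, hBdiag hij]
  have hdet : IsUnit (1 - A).det := (Matrix.isUnit_iff_isUnit_det _).1 hInv
  have hA : 𝒜' = (1 - A)⁻¹ * Matrix.diagonal (fun j => B j j * d₁ j) := by
    rw [h1, hB]
    simp [Matrix.mul_assoc, Matrix.diagonal_mul_diagonal]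
  have hc : ∀ j, B j j * d₁ j ≠ 0 := fun j => mul_ne_zero (hBnz j) (hd j)
  have hinv : 𝒜'⁻¹ = Matrix.diagonal (fun j => (B j j * d₁ j)⁻¹) * (1 - A) := by
    apply Matrix.inv_eq_left_inv
    rw [hA, Matrix.mul_assoc, ← Matrix.mul_assoc (1 - A), Matrix.mul_nonsing_inv _ hdet,
      Matrix.one_mul, Matrix.diagonal_mul_diagonal, ← Matrix.diagonal_one]
    congr 1
    ext j
    exact inv_mul_cancel₀ (hc j)
  have hdiag : (𝒜'⁻¹).diag = fun j => (B j j * d₁ j)⁻¹ := by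
    ext j
    rw [hinv, Matrix.diag_apply, Matrix.diagonal_mul]
    simp [hAdiag]
  have hinv2 : (Matrix.diagonal ((𝒜'⁻¹).diag))⁻¹ = Matrix.diagonal (fun j => B j j * d₁ j) := by
    apply Matrix.inv_eq_left_inv
    rw [hdiag, Matrix.diagonal_mul_diagonal, ← Matrix.diagonal_one]
    congr 1
    ext j
    exact mul_inv_cancel₀ (hc j)
  rw [hinv2, hinv, ← Matrix.mul_assoc, Matrix.diagonal_mul_diagonal]
  have : (fun j => B j j * d₁ j * (B j j * d₁ j)⁻¹) = fun _ => (1 : ℝ) := by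
    ext j
    exact mul_inv_cancel₀ (hc j)
  rw [this, Matrix.diagonal_one, Matrix.one_mul, sub_sub_cancel]
end
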